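/- The twin prime constant satisfies C₂ = ∑_{n odd, n ≥ 1} μ(n)/φ(n)², where the sum runs over all odd positive integers, μ is the Möbius function and φ is Euler's totient function, and the series converges absolutely. -/

import Mathlib

/-- The twin prime constant `C₂ = ∏_{p odd prime} p(p-2)/(p-1)²`. -/
noncomputable def C2 : ℝ :=
  ∏' p : {p : ℕ // p.Prime ∧ p ≠ 2}, ((p : ℕ) : ℝ) * (((p : ℕ) : ℝ) - 2) / (((p : ℕ) : ℝ) - 1) ^ 2

open ArithmeticFunction in
/-- The function `n ↦ μ(n)/φ(n)²` on odd `n`, extended by zero to even `n`. -/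
noncomputable def oddMoebiusDivTotientSq (n : ℕ) : ℝ :=
  if Odd n then (moebius n : ℝ) / (Nat.totient n : ℝ) ^ 2 else 0

theorem pow_three_le_sub_one_pow_five {p : ℕ} (hp : 3 ≤ p) : p ^ 3 ≤ (p - 1) ^ 5 := by
  obtain ⟨k, rfl⟩ := Nat.exists_eq_add_of_le hp
  have h : 3 + k - 1 = k + 2 := by omega
  rw [h]
  ring_nf
  nlinarith [Nat.zero_le (k ^ 2), Nat.zero_le (k ^ 3), Nat.zero_le (k ^ 4), Nat.zero_le (k ^ 5)]

theorem Odd.pow_three_le_totient_pow_five {n : ℕ} (hn : Odd n) : n ^ 3 ≤ n.totient ^ 5 := by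
  induction n using Nat.recOnPosPrimePosCoprime with
  | prime_pow p a hp ha =>
    have hp2 : p ≠ 2 := by
      rintro rfl
      exact Nat.not_odd_iff_even.2 (even_two.pow_of_ne_zero ha.ne') hn
    have hp3 : 3 ≤ p := by have := hp.two_le; omega
    obtain ⟨b, rfl⟩ := Nat.exists_eq_succ_of_ne_zero ha.ne'
    rw [Nat.totient_prime_pow_succ hp, mul_pow]
    calc (p ^ (b + 1)) ^ 3 = (p ^ b) ^ 3 * p ^ 3 := by ring
      _ ≤ (p ^ b) ^ 5 * (p - 1) ^ 5 :=
        Nat.mul_le_mul (Nat.pow_le_pow_right (pow_pos hp.pos b) (by norm_num))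
          (pow_three_le_sub_one_pow_five hp3)
  | zero => simp at hn
  | one => simp
  | coprime a b _ _ hab iha ihb =>
    rw [Nat.odd_mul] at hn
    rw [Nat.totient_mul hab, mul_pow, mul_pow]
    exact Nat.mul_le_mul (iha hn.1) (ihb hn.2)

theorem abs_oddMoebiusDivTotientSq_le (n : ℕ) :
    |oddMoebiusDivTotientSq n| ≤ 1 / (n : ℝ) ^ (6 / 5 : ℝ) := by
  unfold oddMoebiusDivTotientSq
  split_ifs with hn
  · have hμ : |(ArithmeticFunction.moebius n : ℝ)| ≤ 1 := by
      exact_mod_cast ArithmeticFunction.abs_moebius_le_one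
    rw [abs_div, abs_of_nonneg (sq_nonneg (n.totient : ℝ))]
    have hpos : (0 : ℝ) < n := by exact_mod_cast hn.pos
    refine div_le_div₀ zero_le_one hμ (by positivity) ?_
    have h : ((n : ℝ) ^ 3) ≤ (n.totient : ℝ) ^ 5 := by
      exact_mod_cast hn.pow_three_le_totient_pow_five
    have h' := Real.rpow_le_rpow (by positivity) h (by norm_num : (0 : ℝ) ≤ 2 / 5)
    rw [← Real.rpow_natCast, ← Real.rpow_natCast, ← Real.rpow_mul (by positivity),
      ← Real.rpow_mul (by positivity)] at h'
    norm_num at h' ⊢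
    exact h'
  · rw [abs_zero]
    positivity

theorem summable_abs_oddMoebiusDivTotientSq :
    Summable fun n ↦ |oddMoebiusDivTotientSq n| :=
  .of_nonneg_of_le (fun _ ↦ abs_nonneg _) abs_oddMoebiusDivTotientSq_le
    (Real.summable_one_div_nat_rpow.2 (by norm_num))

theorem oddMoebiusDivTotientSq_one : oddMoebiusDivTotientSq 1 = 1 := by
  simp [oddMoebiusDivTotientSq]

theorem oddMoebiusDivTotientSq_mul {m n : ℕ} (h : m.Coprime n) :
    oddMoebiusDivTotientSq (m * n) = oddMoebiusDivTotientSq m * oddMoebiusDivTotientSq n := by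
  unfold oddMoebiusDivTotientSq
  by_cases hm : Odd m <;> by_cases hn : Odd n <;>
    simp [Nat.odd_mul, hm, hn, Nat.totient_mul h,
      ArithmeticFunction.isMultiplicative_moebius.map_mul_of_coprime h]
  ring

theorem tsum_oddMoebiusDivTotientSq_prime_pow {p : ℕ} (hp : p.Prime) :
    ∑' e, oddMoebiusDivTotientSq (p ^ e) = 1 + oddMoebiusDivTotientSq p := by
  rw [tsum_eq_sum (s := Finset.range 2), Finset.sum_range_succ, Finset.sum_range_one, pow_zero,
    pow_one, oddMoebiusDivTotientSq_one]
  intro e he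
  have he : 2 ≤ e := by simpa [Nat.succ_le_iff] using he
  have hμ : ArithmeticFunction.moebius (p ^ e) = 0 := by
    rw [ArithmeticFunction.moebius_apply_prime_pow hp (by omega), if_neg (by omega)]
  simp [oddMoebiusDivTotientSq, hμ]

theorem one_add_oddMoebiusDivTotientSq_prime {p : ℕ} (hp : p.Prime) (hp2 : p ≠ 2) :
    1 + oddMoebiusDivTotientSq p = (p : ℝ) * ((p : ℝ) - 2) / ((p : ℝ) - 1) ^ 2 := by
  have h1 : (p : ℝ) - 1 ≠ 0 := sub_ne_zero.2 (by exact_mod_cast hp.one_lt.ne')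
  rw [oddMoebiusDivTotientSq, if_pos (hp.odd_of_ne_two hp2),
    ArithmeticFunction.moebius_apply_prime hp, Nat.totient_prime hp, Nat.cast_sub hp.one_le]
  push_cast
  field_simp
  ring

theorem tprod_one_add_oddMoebiusDivTotientSq :
    ∏' p : Nat.Primes, (1 + oddMoebiusDivTotientSq p) = C2 := by
  have hC2 : C2 = ∏' p : {p : ℕ | p.Prime ∧ p ≠ 2}, (1 + oddMoebiusDivTotientSq p) :=
    tprod_congr fun p ↦ (one_add_oddMoebiusDivTotientSq_prime p.2.1 p.2.2).symm
  rw [hC2, tprod_subtype {p : ℕ | p.Prime ∧ p ≠ 2} fun p ↦ 1 + oddMoebiusDivTotientSq p]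
  refine (tprod_subtype {p : ℕ | p.Prime} fun p ↦ 1 + oddMoebiusDivTotientSq p).trans ?_
  refine tprod_congr fun p ↦ ?_
  rcases eq_or_ne p 2 with rfl | hp2
  · simp [Set.mulIndicator, oddMoebiusDivTotientSq]
  · simp [Set.mulIndicator, hp2]

/-- `C₂ = ∑_{n odd} μ(n)/φ(n)²`, with the series converging absolutely. -/
theorem twin_prime_constant_series :
    Summable (fun n : ℕ =>
      |if Odd n then (ArithmeticFunction.moebius n : ℝ) / (Nat.totient n : ℝ) ^ 2 else 0|) ∧
    ∑' n : ℕ, (if Odd n then (ArithmeticFunction.moebius n : ℝ) / (Nat.totient n : ℝ) ^ 2 else 0)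
      = C2 := by
  refine ⟨summable_abs_oddMoebiusDivTotientSq, ?_⟩
  rw [← tprod_one_add_oddMoebiusDivTotientSq]
  refine (EulerProduct.eulerProduct_tprod oddMoebiusDivTotientSq_one oddMoebiusDivTotientSq_mul
    summable_abs_oddMoebiusDivTotientSq (by simp [oddMoebiusDivTotientSq])).symm.trans ?_
  exact tprod_congr fun p ↦ tsum_oddMoebiusDivTotientSq_prime_pow p.2
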